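/- For all integers m, t ≥ 1 there exists a constant C = C(m,t) > 0 with the following property. Let β, α₁,…,αₜ ∈ ℝ, let ζ, γ₁,…,γₜ ∈ ℝ^m, let 0 < δ < 1/2, let N ≥ 1 be a real number and N₁,…,Nₜ ≥ 1 integers. Suppose that ‖β + Σ_{j=1}^t αⱼhⱼ + ζ·{Σ_{j=1}^t γⱼhⱼ}‖_{ℝ/ℤ} ≤ 1/(δN) holds for at least δ·N₁⋯Nₜ values of h⃗ ∈ [−N⃗, N⃗], that |αⱼ| ≤ 1/(δNⱼ) for each j, and that |ζ| ≤ 1/δ. Then either max_{1≤l≤m} |ζ_l| ≤ C·δ^{−C}/N, or else there exists k ∈ ℤ^m with 0 < |k| ≤ C·δ^{−C} such that ‖k·γⱼ‖_{ℝ/ℤ} ≤ C·δ^{−C}/Nⱼ for all j = 1,…,t. -/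

import Mathlib

open scoped Classical

/-- `fracNorm x` is the distance from `x` to the nearest integer, `‖x‖_{ℝ/ℤ}`. -/
noncomputable def fracNorm (x : ℝ) : ℝ := |x - round x|

lemma fracNorm_nonneg (x : ℝ) : 0 ≤ fracNorm x := abs_nonneg _

lemma fracNorm_le_half (x : ℝ) : fracNorm x ≤ 1 / 2 := abs_sub_round x

lemma fracNorm_le_abs_sub_intCast (x : ℝ) (n : ℤ) : fracNorm x ≤ |x - n| := round_le x n

lemma fracNorm_le_add_abs (x y : ℝ) : fracNorm x ≤ fracNorm (x + y) + |y| := by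
  have h1 := fracNorm_le_abs_sub_intCast x (round (x + y))
  have h2 : x - round (x + y) = (x + y - round (x + y)) - y := by ring
  rw [h2] at h1
  exact h1.trans (abs_sub _ _)

/-- The additive character `x ↦ e(x) = exp(2πix)`. -/
noncomputable def phase (x : ℝ) : ℂ := Complex.exp ((2 * Real.pi * x : ℝ) * Complex.I)

lemma phase_add (x y : ℝ) : phase (x + y) = phase x * phase y := by
  rw [phase, phase, phase, ← Complex.exp_add]
  congr 1
  push_cast
  ring

lemma phase_zero : phase 0 = 1 := by simp [phase]

lemma norm_phase (x : ℝ) : ‖phase x‖ = 1 := Complex.norm_exp_ofReal_mul_I _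

lemma phase_sum {ι : Type*} (s : Finset ι) (f : ι → ℝ) :
    phase (∑ i ∈ s, f i) = ∏ i ∈ s, phase (f i) := by
  induction s using Finset.induction_on with
  | empty => simp [phase_zero]
  | insert a s ha ih => rw [Finset.sum_insert ha, Finset.prod_insert ha, phase_add, ih]

lemma phase_sub_intCast (x : ℝ) (n : ℤ) : phase (x - n) = phase x := by
  rw [phase, phase, Complex.exp_eq_exp_iff_exists_int]
  refine ⟨-n, ?_⟩
  push_cast
  ring

lemma conj_phase (x : ℝ) : (starRingEnd ℂ) (phase x) = phase (-x) := by
  rw [phase, phase, ← Complex.exp_conj, map_mul, Complex.conj_ofReal, Complex.conj_I]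
  congr 1
  push_cast
  ring

lemma four_mul_fracNorm_le_norm_phase_sub_one (x : ℝ) :
    4 * fracNorm x ≤ ‖phase x - 1‖ := by
  rw [← phase_sub_intCast x (round x), phase, mul_comm _ Complex.I,
    Complex.norm_exp_I_mul_ofReal_sub_one,
    norm_mul, Real.norm_eq_abs, Real.norm_eq_abs, abs_two]
  have hx := abs_sub_round x
  have hpi := Real.pi_pos
  have h1 : |2 * Real.pi * (x - round x) / 2| = Real.pi * |x - round x| := by
    rw [show 2 * Real.pi * (x - round x) / 2 = Real.pi * (x - round x) by ring, abs_mul,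
      abs_of_pos hpi]
  have h2 := Real.mul_abs_le_abs_sin (x := 2 * Real.pi * (x - round x) / 2)
    (by rw [h1]; nlinarith)
  rw [h1] at h2
  have h3 : 2 / Real.pi * (Real.pi * |x - round x|) = 2 * |x - round x| := by
    field_simp
  rw [h3] at h2
  unfold fracNorm
  linarith

lemma half_le_re_phase {x : ℝ} (hx : fracNorm x ≤ 1 / 8) : 1 / 2 ≤ (phase x).re := by
  rw [← phase_sub_intCast x (round x), phase, Complex.exp_ofReal_mul_I_re]
  have h1 := Real.one_sub_sq_div_two_le_cos (x := 2 * Real.pi * (x - round x))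
  have h2 : (x - round x) ^ 2 ≤ (1 / 8) ^ 2 := by
    rw [← sq_abs]
    exact pow_le_pow_left₀ (abs_nonneg _) hx 2
  have h3 : Real.pi ^ 2 ≤ 16 := by nlinarith [Real.pi_pos, Real.pi_le_four]
  have h4 : Real.pi ^ 2 * (x - round x) ^ 2 ≤ 16 * (1 / 8) ^ 2 :=
    mul_le_mul h3 h2 (sq_nonneg _) (by norm_num)
  nlinarith

lemma norm_sum_phase_mul_fracNorm_le (φ : ℝ) (N : ℕ) :
    ‖∑ n ∈ Finset.Icc (-(N : ℤ)) N, phase (φ * n)‖ * fracNorm φ ≤ 1 / 2 := by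
  have hsum : ∑ n ∈ Finset.Icc (-(N : ℤ)) N, phase (φ * n)
      = ∑ i ∈ Finset.range (2 * N + 1), phase (φ * ((i : ℝ) - N)) := by
    refine Finset.sum_nbij' (fun n => (n + N).toNat) (fun i => (i : ℤ) - N) ?_ ?_ ?_ ?_ ?_
    · intro n hn
      simp only [Finset.mem_Icc, Finset.mem_range] at hn ⊢
      omega
    · intro n hn
      simp only [Finset.mem_Icc, Finset.mem_range] at hn ⊢
      omega
    · intro n hn
      simp only [Finset.mem_Icc] at hn ⊢
      omega
    · intro n hn
      simp
    · intro n hn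
      simp only [Finset.mem_Icc] at hn
      have h : ((n + N).toNat : ℤ) = n + N := Int.toNat_of_nonneg (by omega)
      have h' : (((n + N).toNat : ℕ) : ℝ) = n + N := by exact_mod_cast h
      rw [h']
      congr 2
      ring
  have htel : (phase φ - 1) * ∑ n ∈ Finset.Icc (-(N : ℤ)) N, phase (φ * n)
      = phase (φ * (((2 * N + 1 : ℕ) : ℝ) - N)) - phase (φ * (((0 : ℕ) : ℝ) - N)) := by
    rw [hsum, Finset.mul_sum,
      ← Finset.sum_range_sub (fun i : ℕ => phase (φ * ((i : ℝ) - N)))]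
    refine Finset.sum_congr rfl fun i _ => ?_
    rw [sub_mul, one_mul, ← phase_add]
    congr 2
    push_cast
    ring
  have hle : ‖phase φ - 1‖ * ‖∑ n ∈ Finset.Icc (-(N : ℤ)) N, phase (φ * n)‖ ≤ 2 := by
    rw [← norm_mul, htel]
    refine (norm_sub_le _ _).trans ?_
    rw [norm_phase, norm_phase]
    norm_num
  have h4 := four_mul_fracNorm_le_norm_phase_sub_one φ
  nlinarith [mul_le_mul_of_nonneg_right h4
    (norm_nonneg (∑ n ∈ Finset.Icc (-(N : ℤ)) N, phase (φ * n)))]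

lemma card_Icc_neg_self (N : ℕ) : (Finset.Icc (-(N : ℤ)) N).card = 2 * N + 1 := by
  rw [Int.card_Icc]
  omega

lemma norm_sum_box_mul_fracNorm_le {t : ℕ} (φ : Fin t → ℝ) (Nv : Fin t → ℕ) (j : Fin t) :
    ‖∑ h ∈ Finset.Icc (fun j => -(Nv j : ℤ)) (fun j => (Nv j : ℤ)),
        phase (∑ j, φ j * (h j : ℝ))‖ * fracNorm (φ j)
      ≤ 1 / 2 * ∏ i ∈ Finset.univ.erase j, (2 * (Nv i : ℝ) + 1) := by
  have hprod : ∑ h ∈ Finset.Icc (fun j => -(Nv j : ℤ)) (fun j => (Nv j : ℤ)),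
      phase (∑ j, φ j * (h j : ℝ))
      = ∏ j, ∑ n ∈ Finset.Icc (-(Nv j : ℤ)) (Nv j), phase (φ j * n) := by
    rw [Finset.prod_univ_sum, Pi.Icc_eq]
    exact Finset.sum_congr rfl fun h _ => phase_sum _ _
  rw [hprod, norm_prod, ← Finset.mul_prod_erase _ _ (Finset.mem_univ j), mul_right_comm]
  refine mul_le_mul (norm_sum_phase_mul_fracNorm_le _ _) ?_
    (Finset.prod_nonneg fun _ _ => norm_nonneg _) (by norm_num)
  refine Finset.prod_le_prod (fun _ _ => norm_nonneg _) fun i _ => ?_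
  refine (norm_sum_le _ _).trans ?_
  simp only [norm_phase, Finset.sum_const, card_Icc_neg_self, nsmul_eq_mul, mul_one]
  push_cast
  exact le_rfl

/-- A second moment argument: if all the phases `f k h` are close to `0` modulo `1` for a set of
`h` that is large compared with the number of phases, then two of them correlate. -/
lemma exists_le_norm_sum_phase_sub {ι κ : Type*} [Fintype κ] (s H : Finset ι) (hH : H ⊆ s)
    (f : κ → ι → ℝ) (hf : ∀ h ∈ H, ∀ k, fracNorm (f k h) ≤ 1 / 8)
    (hcard : 8 * (s.card : ℝ) < H.card * Fintype.card κ) :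
    ∃ k k' : κ, k ≠ k' ∧ (H.card : ℝ) / 8 ≤ ‖∑ h ∈ s, phase (f k h - f k' h)‖ := by
  by_contra! hcon
  set K : ℝ := (Fintype.card κ : ℝ) with hK
  have hK0 : 0 ≤ K := Nat.cast_nonneg _
  have hs0 : (0 : ℝ) ≤ s.card := Nat.cast_nonneg _
  have hH0 : (0 : ℝ) ≤ H.card := Nat.cast_nonneg _
  have lower : (H.card : ℝ) * (K / 2) ^ 2 ≤ ∑ h ∈ s, ‖∑ k, phase (f k h)‖ ^ 2 := by
    calc (H.card : ℝ) * (K / 2) ^ 2 = ∑ h ∈ H, (K / 2) ^ 2 := by simp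
      _ ≤ ∑ h ∈ H, ‖∑ k, phase (f k h)‖ ^ 2 := by
        refine Finset.sum_le_sum fun h hh => pow_le_pow_left₀ (by positivity) ?_ 2
        refine le_trans ?_ (Complex.re_le_norm _)
        rw [Complex.re_sum]
        calc K / 2 = ∑ _k : κ, (1 / 2 : ℝ) := by simp [hK]; ring
          _ ≤ _ := Finset.sum_le_sum fun k _ => half_le_re_phase (hf h hh k)
      _ ≤ _ := Finset.sum_le_sum_of_subset_of_nonneg hH fun _ _ _ => by positivity
  have expand : ((∑ h ∈ s, ‖∑ k, phase (f k h)‖ ^ 2 : ℝ) : ℂ)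
      = ∑ k, ∑ k', ∑ h ∈ s, phase (f k h - f k' h) := by
    have : ∀ h, ((‖∑ k, phase (f k h)‖ ^ 2 : ℝ) : ℂ) = ∑ k, ∑ k', phase (f k h - f k' h) := by
      intro h
      push_cast
      rw [← Complex.mul_conj', map_sum, Finset.sum_mul_sum]
      refine Finset.sum_congr rfl fun k _ => Finset.sum_congr rfl fun k' _ => ?_
      rw [conj_phase, ← phase_add, sub_eq_add_neg]
    rw [Complex.ofReal_sum, Finset.sum_congr rfl fun h _ => this h, Finset.sum_comm]
    exact Finset.sum_congr rfl fun k _ => Finset.sum_comm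
  have upper : ∑ h ∈ s, ‖∑ k, phase (f k h)‖ ^ 2 ≤ K * s.card + K * K * (H.card / 8) := by
    have h0 : 0 ≤ ∑ h ∈ s, ‖∑ k, phase (f k h)‖ ^ 2 := Finset.sum_nonneg fun _ _ => by positivity
    calc ∑ h ∈ s, ‖∑ k, phase (f k h)‖ ^ 2
        = ‖∑ k, ∑ k', ∑ h ∈ s, phase (f k h - f k' h)‖ := by
          rw [← expand, Complex.norm_real, Real.norm_of_nonneg h0]
      _ ≤ ∑ k, ∑ k', ((if k = k' then (s.card : ℝ) else 0) + H.card / 8) := by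
          refine (norm_sum_le _ _).trans (Finset.sum_le_sum fun k _ => ?_)
          refine (norm_sum_le _ _).trans (Finset.sum_le_sum fun k' _ => ?_)
          split_ifs with h
          · subst h
            simp only [sub_self, phase_zero, Finset.sum_const, nsmul_eq_mul, mul_one,
              Complex.norm_natCast]
            linarith
          · rw [zero_add]
            exact (hcon k k' h).le
      _ = K * s.card + K * K * (H.card / 8) := by
          simp only [Finset.sum_add_distrib, Finset.sum_ite_eq, Finset.mem_univ, if_true,
            Finset.sum_const, Finset.card_univ, nsmul_eq_mul]
          ring
  have hKpos : 0 < K := by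
    rcases hK0.lt_or_eq with h | h
    · exact h
    · rw [← h] at hcard
      linarith
  nlinarith

/-- If many points `h` of a box have all `∑ⱼ θⱼₗhⱼ` close modulo `1` to fixed numbers, then
the `θⱼ` satisfy an approximate linear relation with small integer coefficients. -/
lemma exists_approx_relation {m t : ℕ} (Nv : Fin t → ℕ) (θ : Fin t → Fin m → ℝ) (x : Fin m → ℝ)
    (Q : ℕ) (η : ℝ) (hη : m * Q * η ≤ 1 / 8) (H : Finset (Fin t → ℤ))
    (hH : H ⊆ Finset.Icc (fun j => -(Nv j : ℤ)) (fun j => (Nv j : ℤ)))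
    (hclose : ∀ h ∈ H, ∀ l, ∃ n : ℤ, |∑ j, θ j l * (h j : ℝ) - x l - n| ≤ η)
    (hcard : 8 * ∏ j, (2 * (Nv j : ℝ) + 1) < H.card * (Q : ℝ) ^ m) :
    ∃ k : Fin m → ℤ, k ≠ 0 ∧ (∀ l, (|k l| : ℝ) ≤ Q) ∧
      ∀ j, H.card * fracNorm (∑ l, (k l : ℝ) * θ j l)
        ≤ 4 * ∏ i ∈ Finset.univ.erase j, (2 * (Nv i : ℝ) + 1) := by
  obtain ⟨k, k', hkk, hlarge⟩ := exists_le_norm_sum_phase_sub (κ := Fin m → Fin Q) _ H hH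
    (fun k h => ∑ l, (k l : ℝ) * (∑ j, θ j l * (h j : ℝ) - x l)) (by
      intro h hh k
      choose n hn using hclose h hh
      refine (fracNorm_le_abs_sub_intCast _ (∑ l, (k l : ℤ) * n l)).trans (le_trans ?_ hη)
      push_cast
      rw [← Finset.sum_sub_distrib]
      refine (Finset.abs_sum_le_sum_abs _ _).trans ?_
      calc _ ≤ ∑ _l : Fin m, Q * η := by
            refine Finset.sum_le_sum fun l _ => ?_
            rw [← mul_sub, abs_mul, Nat.abs_cast]
            exact mul_le_mul (by exact_mod_cast (k l).2.le) (hn l) (abs_nonneg _)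
              (Nat.cast_nonneg _)
        _ = m * Q * η := by
            rw [Finset.sum_const, Finset.card_univ, Fintype.card_fin, nsmul_eq_mul, mul_assoc])
    (by
      have hc : ((Finset.Icc (fun j => -(Nv j : ℤ)) (fun j => (Nv j : ℤ))).card : ℝ)
          = ∏ j, (2 * (Nv j : ℝ) + 1) := by
        rw [Pi.card_Icc]
        push_cast [card_Icc_neg_self]
        rfl
      rw [hc]
      simpa using hcard)
  refine ⟨fun l => (k l : ℤ) - (k' l : ℤ), ?_, ?_, ?_⟩
  · contrapose! hkk
    funext l
    have := congrFun hkk l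
    simp only [Pi.zero_apply] at this
    exact Fin.ext (by omega)
  · intro l
    have h1 : |(k l : ℤ) - (k' l : ℤ)| ≤ Q := by
      have := (k l).2
      have := (k' l).2
      rw [abs_le]
      omega
    exact_mod_cast h1
  · intro j
    set φ : Fin t → ℝ := fun j => ∑ l, (((k l : ℤ) - (k' l : ℤ) : ℤ) : ℝ) * θ j l with hφ
    have hsum : ∀ h : Fin t → ℤ,
        (∑ l, (k l : ℝ) * (∑ j, θ j l * (h j : ℝ) - x l))
          - (∑ l, (k' l : ℝ) * (∑ j, θ j l * (h j : ℝ) - x l))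
        = ∑ j, φ j * (h j : ℝ) + ∑ l, ((k' l : ℝ) - k l) * x l := by
      intro h
      simp only [hφ, Finset.sum_mul]
      rw [Finset.sum_comm, ← Finset.sum_sub_distrib, ← Finset.sum_add_distrib]
      refine Finset.sum_congr rfl fun l _ => ?_
      simp only [mul_assoc, ← Finset.mul_sum]
      push_cast
      ring
    simp only [hsum, phase_add] at hlarge
    rw [← Finset.sum_mul, norm_mul, norm_phase, mul_one] at hlarge
    have h1 := norm_sum_box_mul_fracNorm_le φ Nv j
    have h2 := mul_le_mul_of_nonneg_right hlarge (fracNorm_nonneg (φ j))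
    have h3 : (H.card : ℝ) * fracNorm (φ j)
        ≤ 4 * ∏ i ∈ Finset.univ.erase j, (2 * (Nv i : ℝ) + 1) := by linarith
    exact h3

lemma mul_card_le_of_forall_mul_abs_sub_le (S : Finset ℤ) {a D : ℝ} (ha : 0 ≤ a) (hD : 0 ≤ D)
    (hS : ∀ x ∈ S, ∀ y ∈ S, a * |(x : ℝ) - y| ≤ D) : a * S.card ≤ D + a := by
  rcases S.eq_empty_or_nonempty with rfl | hne
  · simp
    positivity
  have hle : S.min' hne ≤ S.max' hne := S.min'_le _ (S.max'_mem hne)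
  have hsub : S ⊆ Finset.Icc (S.min' hne) (S.max' hne) := fun x hx =>
    Finset.mem_Icc.2 ⟨S.min'_le x hx, S.le_max' x hx⟩
  have hcard := Finset.card_le_card hsub
  rw [Int.card_Icc] at hcard
  have hcard' : (S.card : ℤ) ≤ S.max' hne - S.min' hne + 1 := by omega
  have hcardR : (S.card : ℝ) ≤ S.max' hne - S.min' hne + 1 := by exact_mod_cast hcard'
  have h := hS _ (S.max'_mem hne) _ (S.min'_mem hne)
  rw [abs_of_nonneg (sub_nonneg.2 (by exact_mod_cast hle))] at h
  nlinarith

/-- A subset of a box that is thin in every line parallel to the `j`-th axis is small. -/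
lemma mul_card_le_of_thin_lines {t : ℕ} (Nv : Fin t → ℕ) (j : Fin t) (H : Finset (Fin t → ℤ))
    (hH : H ⊆ Finset.Icc (fun j => -(Nv j : ℤ)) (fun j => (Nv j : ℤ))) {a D : ℝ} (ha : 0 ≤ a)
    (hD : 0 ≤ D)
    (hline : ∀ h ∈ H, ∀ h' ∈ H, (∀ i, i ≠ j → h i = h' i) → a * |(h j : ℝ) - h' j| ≤ D) :
    a * H.card ≤ (D + a) * ∏ i ∈ Finset.univ.erase j, (2 * (Nv i : ℝ) + 1) := by
  set T : Finset (Fin t → ℤ) :=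
    Fintype.piFinset fun i => if i = j then {0} else Finset.Icc (-(Nv i : ℤ)) (Nv i) with hT
  have hTcard : (T.card : ℝ) = ∏ i ∈ Finset.univ.erase j, (2 * (Nv i : ℝ) + 1) := by
    rw [hT, Fintype.card_piFinset, ← Finset.mul_prod_erase _ _ (Finset.mem_univ j), if_pos rfl,
      Finset.card_singleton, one_mul]
    push_cast
    refine Finset.prod_congr rfl fun i hi => ?_
    rw [if_neg (Finset.ne_of_mem_erase hi), card_Icc_neg_self]
    push_cast
    rfl
  have hmaps : ∀ h ∈ H, Function.update h j 0 ∈ T := by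
    intro h hh
    have := Finset.mem_Icc.1 (hH hh)
    rw [hT, Fintype.mem_piFinset]
    intro i
    by_cases hi : i = j
    · subst hi
      simp
    · rw [if_neg hi, Function.update_of_ne hi]
      exact Finset.mem_Icc.2 ⟨this.1 i, this.2 i⟩
  rw [Finset.card_eq_sum_card_fiberwise hmaps, ← hTcard, mul_comm (D + a), ← nsmul_eq_mul]
  push_cast
  rw [Finset.mul_sum]
  refine Finset.sum_le_card_nsmul _ _ _ fun u _ => ?_
  have hoff : ∀ h ∈ H.filter (fun h => Function.update h j 0 = u), ∀ i, i ≠ j → h i = u i := by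
    intro h hh i hi
    rw [← (Finset.mem_filter.1 hh).2, Function.update_of_ne hi]
  have hinj : Set.InjOn (fun h : Fin t → ℤ => h j)
      (H.filter (fun h => Function.update h j 0 = u)) := by
    intro h hh h' hh' heq
    funext i
    by_cases hi : i = j
    · subst hi
      exact heq
    · rw [hoff h hh i hi, hoff h' hh' i hi]
  rw [← Finset.card_image_of_injOn hinj]
  refine mul_card_le_of_forall_mul_abs_sub_le _ ha hD fun x hx y hy => ?_
  obtain ⟨h, hh, rfl⟩ := Finset.mem_image.1 hx
  obtain ⟨h', hh', rfl⟩ := Finset.mem_image.1 hy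
  exact hline h (Finset.mem_filter.1 hh).1 h' (Finset.mem_filter.1 hh').1 fun i hi => by
    rw [hoff h hh i hi, hoff h' hh' i hi]

/-- The case of the theorem in which the bracket expression is nearly constant as a real number
and all but one of the fractional parts are nearly constant. -/
lemma exists_approx_relation_of_bracket {m t : ℕ} (Nv : Fin t → ℕ) (α : Fin t → ℝ)
    (ζ : Fin m → ℝ) (γ : Fin t → Fin m → ℝ) (l₀ : Fin m) (hζ₀ : ζ l₀ ≠ 0)
    (hζ : ∀ l, |ζ l| ≤ |ζ l₀|) (Q : ℕ) (hQ : 1 ≤ Q) (ε ρ : ℝ) (hε : 0 ≤ ε)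
    (hρ : 8 * m ^ 2 * Q * ρ ≤ 1) (hερ : 2 * ε ≤ |ζ l₀| * ρ) (H : Finset (Fin t → ℤ))
    (hH : H ⊆ Finset.Icc (fun j => -(Nv j : ℤ)) (fun j => (Nv j : ℤ)))
    (hval : ∀ h ∈ H, ∀ h' ∈ H, |∑ j, α j * ((h j : ℝ) - h' j)
      + ∑ l, ζ l * (Int.fract (∑ j, γ j l * (h j : ℝ)) - Int.fract (∑ j, γ j l * (h' j : ℝ)))|
        ≤ 2 * ε)
    (hcell : ∀ h ∈ H, ∀ h' ∈ H, ∀ l, l ≠ l₀ →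
      |Int.fract (∑ j, γ j l * (h j : ℝ)) - Int.fract (∑ j, γ j l * (h' j : ℝ))| ≤ ρ)
    (hcard : 8 * ∏ j, (2 * (Nv j : ℝ) + 1) < H.card * (Q : ℝ) ^ m) :
    ∃ k : Fin m → ℤ, k ≠ 0 ∧ (∀ l, (|k l| : ℝ) ≤ Q) ∧
      ∀ j, H.card * fracNorm (∑ l, (k l : ℝ) * γ j l)
        ≤ (4 + 2 * (m + 1) * Q) * ∏ i ∈ Finset.univ.erase j, (2 * (Nv i : ℝ) + 1) := by
  have hZ : 0 < |ζ l₀| := abs_pos.2 hζ₀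
  have hm1 : (1 : ℝ) ≤ m := by
    have : 0 < m := Fin.pos l₀
    exact_mod_cast this
  have hQ1 : (1 : ℝ) ≤ Q := by exact_mod_cast hQ
  have hρ0 : 0 ≤ ρ := by
    by_contra! hneg
    nlinarith [mul_neg_of_pos_of_neg hZ hneg]
  have hρ1 : 2 * ε ≤ |ζ l₀| := by
    refine hερ.trans (mul_le_of_le_one_right hZ.le ?_)
    have : (1 : ℝ) ≤ 8 * m ^ 2 * Q := by nlinarith [one_le_pow₀ hm1 (n := 2)]
    nlinarith
  have hfr : ∀ x y : ℝ, |Int.fract x - Int.fract y| ≤ 1 := fun x y => by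
    rw [abs_le]
    constructor <;> linarith [Int.fract_nonneg x, Int.fract_nonneg y, (Int.fract_lt_one x).le,
      (Int.fract_lt_one y).le]
  obtain ⟨h₀, hh₀⟩ : H.Nonempty := by
    rw [Finset.nonempty_iff_ne_empty]
    rintro rfl
    have : (0 : ℝ) ≤ ∏ j, (2 * (Nv j : ℝ) + 1) := Finset.prod_nonneg fun _ _ => by positivity
    simp at hcard
    linarith
  -- The lines parallel to each axis are thin, which bounds the `αⱼ` in terms of `ζ`.
  have hα : ∀ j, |α j| * H.card
      ≤ ((m + 1) * |ζ l₀| + |α j|) * ∏ i ∈ Finset.univ.erase j, (2 * (Nv i : ℝ) + 1) := by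
    intro j
    refine mul_card_le_of_thin_lines Nv j H hH (abs_nonneg _) (by positivity) ?_
    intro h hh h' hh' hoff
    have h1 := hval h hh h' hh'
    have h2 : ∑ i, α i * ((h i : ℝ) - h' i) = α j * ((h j : ℝ) - h' j) :=
      Finset.sum_eq_single j (fun i _ hi => by rw [hoff i hi, sub_self, mul_zero])
        (fun hj => absurd (Finset.mem_univ j) hj)
    have h3 : |∑ l, ζ l * (Int.fract (∑ j, γ j l * (h j : ℝ))
        - Int.fract (∑ j, γ j l * (h' j : ℝ)))| ≤ m * |ζ l₀| := by
      refine (Finset.abs_sum_le_sum_abs _ _).trans ?_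
      calc _ ≤ ∑ _l : Fin m, |ζ l₀| * 1 := Finset.sum_le_sum fun l _ => by
            rw [abs_mul]
            exact mul_le_mul (hζ l) (hfr _ _) (abs_nonneg _) hZ.le
        _ = _ := by simp
    rw [h2] at h1
    rw [← abs_mul]
    have h4 := abs_sub_abs_le_abs_add (α j * ((h j : ℝ) - h' j)) (∑ l, ζ l *
      (Int.fract (∑ j, γ j l * (h j : ℝ)) - Int.fract (∑ j, γ j l * (h' j : ℝ))))
    linarith
  set θ : Fin t → Fin m → ℝ := fun j l => γ j l + if l = l₀ then α j / ζ l₀ else 0 with hθ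
  obtain ⟨k, hk0, hkQ, hk⟩ := exists_approx_relation Nv θ (fun l => ∑ j, θ j l * (h₀ j : ℝ)) Q
    (m * ρ) (by nlinarith) H hH (by
      intro h hh l
      refine ⟨⌊∑ j, γ j l * (h j : ℝ)⌋ - ⌊∑ j, γ j l * (h₀ j : ℝ)⌋, ?_⟩
      have e1 := Int.floor_add_fract (∑ j, γ j l * (h j : ℝ))
      have e2 := Int.floor_add_fract (∑ j, γ j l * (h₀ j : ℝ))
      by_cases hl : l = l₀
      · subst hl
        have e3 : ∀ h : Fin t → ℤ, ∑ j, θ j l * (h j : ℝ)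
            = ∑ j, γ j l * (h j : ℝ) + (∑ j, α j * (h j : ℝ)) / ζ l := by
          intro h
          rw [Finset.sum_div, ← Finset.sum_add_distrib]
          refine Finset.sum_congr rfl fun j _ => ?_
          simp only [hθ, if_true]
          ring
        rw [e3, e3]
        push_cast
        have h1 := hval h hh h₀ hh₀
        simp only [mul_sub (α _), Finset.sum_sub_distrib] at h1
        rw [← Finset.add_sum_erase _ _ (Finset.mem_univ l)] at h1
        set A := ∑ j, α j * (h j : ℝ)
        set A₀ := ∑ j, α j * (h₀ j : ℝ)
        set R := ∑ l' ∈ Finset.univ.erase l, ζ l' *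
          (Int.fract (∑ j, γ j l' * (h j : ℝ)) - Int.fract (∑ j, γ j l' * (h₀ j : ℝ))) with hR
        have h2 : |R| ≤ (m - 1) * (|ζ l| * ρ) := by
          refine (Finset.abs_sum_le_sum_abs _ _).trans ?_
          calc _ ≤ ∑ _l' ∈ Finset.univ.erase l, |ζ l| * ρ :=
                Finset.sum_le_sum fun l' hl' => by
                  rw [abs_mul]
                  exact mul_le_mul (hζ l') (hcell h hh h₀ hh₀ l' (Finset.ne_of_mem_erase hl'))
                    (abs_nonneg _) hZ.le
            _ = _ := by
                rw [Finset.sum_const, nsmul_eq_mul, Finset.card_erase_of_mem (Finset.mem_univ _),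
                  Finset.card_univ, Fintype.card_fin, Nat.cast_sub (by exact_mod_cast hm1),
                  Nat.cast_one]
        refine le_of_mul_le_mul_left ?_ hZ
        rw [← abs_mul]
        have e4 : ζ l * (∑ j, γ j l * (h j : ℝ) + A / ζ l - (∑ j, γ j l * (h₀ j : ℝ) + A₀ / ζ l)
            - ((⌊∑ j, γ j l * (h j : ℝ)⌋ : ℝ) - ⌊∑ j, γ j l * (h₀ j : ℝ)⌋))
            = (A - A₀ + (ζ l * (Int.fract (∑ j, γ j l * (h j : ℝ))
              - Int.fract (∑ j, γ j l * (h₀ j : ℝ))) + R)) - R := by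
          rw [Int.fract, Int.fract]
          field_simp
          ring
        rw [e4]
        refine (abs_sub _ _).trans ?_
        linarith
      · have e3 : ∀ j, θ j l = γ j l := fun j => by simp [hθ, hl]
        simp only [e3]
        have h1 := hcell h hh h₀ hh₀ l hl
        have e4 : ∑ j, γ j l * (h j : ℝ) - ∑ j, γ j l * (h₀ j : ℝ)
            - ((⌊∑ j, γ j l * (h j : ℝ)⌋ - ⌊∑ j, γ j l * (h₀ j : ℝ)⌋ : ℤ) : ℝ)
            = Int.fract (∑ j, γ j l * (h j : ℝ)) - Int.fract (∑ j, γ j l * (h₀ j : ℝ)) := by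
          rw [Int.fract, Int.fract]
          push_cast
          ring
        rw [e4]
        nlinarith) hcard
  refine ⟨k, hk0, hkQ, fun j => ?_⟩
  have hP : 0 ≤ ∏ i ∈ Finset.univ.erase j, (2 * (Nv i : ℝ) + 1) :=
    Finset.prod_nonneg fun _ _ => by positivity
  have hαj := hα j
  have hkj := hk j
  set P := ∏ i ∈ Finset.univ.erase j, (2 * (Nv i : ℝ) + 1)
  have hmQ : 0 ≤ 2 * ((m : ℝ) + 1) * Q := by positivity
  have hH0 : (0 : ℝ) ≤ H.card := Nat.cast_nonneg _
  rcases le_or_gt (H.card : ℝ) (2 * P) with hsmall | hbig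
  · calc H.card * fracNorm (∑ l, (k l : ℝ) * γ j l) ≤ 2 * P * (1 / 2) :=
          mul_le_mul hsmall (fracNorm_le_half _) (fracNorm_nonneg _) (by positivity)
      _ ≤ _ := by nlinarith
  · have h1 : |α j| * H.card ≤ 2 * (m + 1) * |ζ l₀| * P := by
      nlinarith [abs_nonneg (α j)]
    have h2 : |k l₀ * (α j / ζ l₀)| * H.card ≤ 2 * (m + 1) * Q * P := by
      rw [abs_mul, abs_div]
      have h3 : |α j| / |ζ l₀| * H.card ≤ 2 * (m + 1) * P := by
        rw [div_mul_eq_mul_div, div_le_iff₀ hZ]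
        linarith
      have h4 := mul_le_mul (hkQ l₀) h3 (by positivity) (by positivity)
      linarith
    have e1 : ∑ l, (k l : ℝ) * θ j l = ∑ l, (k l : ℝ) * γ j l + k l₀ * (α j / ζ l₀) := by
      simp [hθ, mul_add, Finset.sum_add_distrib]
    have h3 := fracNorm_le_add_abs (∑ l, (k l : ℝ) * γ j l) (k l₀ * (α j / ζ l₀))
    rw [← e1] at h3
    nlinarith

/-- Pigeonholing on the nearest integer and on the fractional parts other than the `l₀`-th. -/
lemma exists_dense_fiber {m t : ℕ} (β : ℝ) (α : Fin t → ℝ)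
    (ζ : Fin m → ℝ) (γ : Fin t → Fin m → ℝ) (l₀ : Fin m) (Nv : Fin t → ℕ) (M : ℕ) (hM : 1 ≤ M)
    (W ε : ℝ) (hW : 0 ≤ W) (hα : ∑ j, |α j| * (Nv j : ℝ) + ∑ l, |ζ l| ≤ W)
    (H : Finset (Fin t → ℤ))
    (hH : H ⊆ Finset.Icc (fun j => -(Nv j : ℤ)) (fun j => (Nv j : ℤ)))
    (hval : ∀ h ∈ H, fracNorm (β + (∑ j, α j * (h j : ℝ))
        + ∑ l, ζ l * Int.fract (∑ j, γ j l * (h j : ℝ))) ≤ ε) :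
    ∃ H' ⊆ H, (H.card : ℝ) ≤ (2 * W + 2) * (M : ℝ) ^ (m - 1) * H'.card ∧
      (∀ h ∈ H', ∀ h' ∈ H', |∑ j, α j * ((h j : ℝ) - h' j)
        + ∑ l, ζ l * (Int.fract (∑ j, γ j l * (h j : ℝ)) - Int.fract (∑ j, γ j l * (h' j : ℝ)))|
          ≤ 2 * ε) ∧
      ∀ h ∈ H', ∀ h' ∈ H', ∀ l, l ≠ l₀ →
        |Int.fract (∑ j, γ j l * (h j : ℝ)) - Int.fract (∑ j, γ j l * (h' j : ℝ))|
          ≤ 1 / (M : ℝ) := by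
  have hM0 : (0 : ℝ) < M := by exact_mod_cast hM
  set F : (Fin t → ℤ) → ℝ := fun h =>
    β + (∑ j, α j * (h j : ℝ)) + ∑ l, ζ l * Int.fract (∑ j, γ j l * (h j : ℝ)) with hF
  set T₁ : Finset ℤ := Finset.Icc ⌈β - (W + 1 / 2)⌉ ⌊β + (W + 1 / 2)⌋ with hT₁
  set T₂ : Finset ({l : Fin m // l ≠ l₀} → ℤ) :=
    Fintype.piFinset fun _ => Finset.Ico (0 : ℤ) M with hT₂
  have hFβ : ∀ h ∈ H, |F h - β| ≤ W := by
    intro h hh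
    have hbox := Finset.mem_Icc.1 (hH hh)
    have e : F h - β = (∑ j, α j * (h j : ℝ))
        + ∑ l, ζ l * Int.fract (∑ j, γ j l * (h j : ℝ)) := by
      simp only [hF]
      ring
    rw [e]
    refine (abs_add_le _ _).trans (le_trans (add_le_add ?_ ?_) hα)
    · refine (Finset.abs_sum_le_sum_abs _ _).trans (Finset.sum_le_sum fun j _ => ?_)
      rw [abs_mul]
      refine mul_le_mul_of_nonneg_left ?_ (abs_nonneg _)
      have : |h j| ≤ (Nv j : ℤ) := abs_le.2 ⟨hbox.1 j, hbox.2 j⟩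
      exact_mod_cast this
    · refine (Finset.abs_sum_le_sum_abs _ _).trans (Finset.sum_le_sum fun l _ => ?_)
      rw [abs_mul, Int.abs_fract]
      exact mul_le_of_le_one_right (abs_nonneg _) (Int.fract_lt_one _).le
  have hmaps : ∀ h ∈ H, (round (F h), fun l : {l : Fin m // l ≠ l₀} =>
      ⌊(M : ℝ) * Int.fract (∑ j, γ j l * (h j : ℝ))⌋) ∈ T₁ ×ˢ T₂ := by
    intro h hh
    rw [Finset.mem_product]
    constructor
    · have h1 := abs_le.1 (hFβ h hh)
      have h2 := abs_le.1 (abs_sub_round (F h))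
      rw [hT₁, Finset.mem_Icc, Int.ceil_le, Int.le_floor]
      constructor <;> linarith [h1.1, h1.2, h2.1, h2.2]
    · rw [hT₂, Fintype.mem_piFinset]
      intro l
      rw [Finset.mem_Ico, Int.floor_lt]
      refine ⟨Int.floor_nonneg.2 (mul_nonneg hM0.le (Int.fract_nonneg _)), ?_⟩
      push_cast
      exact mul_lt_of_lt_one_right hM0 (Int.fract_lt_one _)
  rcases H.eq_empty_or_nonempty with rfl | hne
  · exact ⟨∅, Finset.empty_subset _, by simp, by simp, by simp⟩
  have hTne : (T₁ ×ˢ T₂).Nonempty := by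
    obtain ⟨h, hh⟩ := hne
    exact ⟨_, hmaps h hh⟩
  have hTpos : (0 : ℝ) < (T₁ ×ˢ T₂).card := by exact_mod_cast hTne.card_pos
  have hTcard : ((T₁ ×ˢ T₂).card : ℝ) ≤ (2 * W + 2) * (M : ℝ) ^ (m - 1) := by
    rw [Finset.card_product, hT₂, Fintype.card_piFinset]
    simp only [Int.card_Ico, sub_zero, Int.toNat_natCast, Finset.prod_const, Finset.card_univ]
    have hsub : Fintype.card {l : Fin m // l ≠ l₀} = m - 1 := by
      simp [Fintype.card_subtype_compl]
    rw [hsub]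
    push_cast
    refine mul_le_mul_of_nonneg_right ?_ (by positivity)
    rw [hT₁, Int.card_Icc]
    have h1 := Int.floor_le (β + (W + 1 / 2))
    have h2 := Int.le_ceil (β - (W + 1 / 2))
    rcases le_total 0 (⌊β + (W + 1 / 2)⌋ + 1 - ⌈β - (W + 1 / 2)⌉) with h | h
    · have h3 : (((⌊β + (W + 1 / 2)⌋ + 1 - ⌈β - (W + 1 / 2)⌉).toNat : ℤ) : ℝ)
          = ⌊β + (W + 1 / 2)⌋ + 1 - ⌈β - (W + 1 / 2)⌉ := by
        rw [Int.toNat_of_nonneg h]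
        push_cast
        ring
      rw [Int.cast_natCast] at h3
      rw [h3]
      linarith
    · rw [Int.toNat_of_nonpos h]
      push_cast
      positivity
  obtain ⟨y, -, hy⟩ := Finset.exists_le_card_fiber_of_nsmul_le_card_of_maps_to
    (b := (H.card : ℝ) / (T₁ ×ˢ T₂).card) hmaps hTne
    (by rw [nsmul_eq_mul, mul_div_cancel₀ _ hTpos.ne'])
  refine ⟨H.filter fun h => (round (F h), fun l : {l : Fin m // l ≠ l₀} =>
      ⌊(M : ℝ) * Int.fract (∑ j, γ j l * (h j : ℝ))⌋) = y, Finset.filter_subset _ _, ?_, ?_, ?_⟩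
  rotate_left
  · intro h hh h' hh'
    obtain ⟨hhH, hhy⟩ := Finset.mem_filter.1 hh
    obtain ⟨hhH', hhy'⟩ := Finset.mem_filter.1 hh'
    have hr : round (F h) = round (F h') := congrArg Prod.fst (hhy.trans hhy'.symm)
    have h1 : |F h - round (F h)| ≤ ε := hval h hhH
    have h2 : |F h' - round (F h')| ≤ ε := hval h' hhH'
    rw [← hr] at h2
    have e : ∑ j, α j * ((h j : ℝ) - h' j) + ∑ l, ζ l *
        (Int.fract (∑ j, γ j l * (h j : ℝ)) - Int.fract (∑ j, γ j l * (h' j : ℝ)))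
        = (F h - round (F h)) - (F h' - round (F h)) := by
      simp only [hF, mul_sub, Finset.sum_sub_distrib]
      ring
    rw [e]
    refine (abs_sub _ _).trans ?_
    linarith
  · intro h hh h' hh' l hl
    obtain ⟨hhH, hhy⟩ := Finset.mem_filter.1 hh
    obtain ⟨hhH', hhy'⟩ := Finset.mem_filter.1 hh'
    have hr := congrFun (congrArg Prod.snd (hhy.trans hhy'.symm)) ⟨l, hl⟩
    have h1 := (Int.abs_sub_lt_one_of_floor_eq_floor hr).le
    rw [← mul_sub, abs_mul, abs_of_pos hM0] at h1
    rw [le_div_iff₀ hM0]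
    linarith
  · rw [div_le_iff₀ hTpos] at hy
    refine hy.trans ?_
    rw [mul_comm]
    exact mul_le_mul_of_nonneg_right hTcard (Nat.cast_nonneg _)

set_option maxHeartbeats 1000000 in
/-- multiparameter version of Proposition 5.3: if
`‖β + Σⱼαⱼhⱼ + ζ·{Σⱼγⱼhⱼ}‖_{ℝ/ℤ} ≤ 1/(δN)` for at least `δN₁⋯Nₜ` values of
`h⃗ ∈ [−N⃗,N⃗]`, with `|αⱼ| ≤ 1/(δNⱼ)` and `|ζ| ≤ 1/δ`, then either
`max_l |ζ_l| ≤ Cδ^{-C}/N`, or there is `k ∈ ℤ^m` with `0 < |k| ≤ Cδ^{-C}` and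
`‖k·γⱼ‖_{ℝ/ℤ} ≤ Cδ^{-C}/Nⱼ` for all `j`. -/
theorem stmt9 :
    ∀ m t : ℕ, 1 ≤ m → 1 ≤ t →
      ∃ C : ℝ, 0 < C ∧
        ∀ (β : ℝ) (α : Fin t → ℝ) (ζ : Fin m → ℝ) (γ : Fin t → Fin m → ℝ)
          (δ N : ℝ) (Nv : Fin t → ℕ),
          0 < δ → δ < 1/2 → 1 ≤ N → (∀ j, 1 ≤ Nv j) →
          (∀ j, |α j| ≤ 1 / (δ * (Nv j : ℝ))) →
          (∀ l, |ζ l| ≤ 1 / δ) →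
          δ * ∏ j, (Nv j : ℝ) ≤
            (((Finset.Icc (fun j => -(Nv j : ℤ)) (fun j => (Nv j : ℤ))).filter
              (fun h : Fin t → ℤ =>
                fracNorm (β + (∑ j, α j * (h j : ℝ))
                  + ∑ l, ζ l * Int.fract (∑ j, γ j l * (h j : ℝ))) ≤ 1 / (δ * N))).card : ℝ) →
          (∀ l, |ζ l| ≤ C * δ ^ (-C) / N) ∨
            ∃ k : Fin m → ℤ, k ≠ 0 ∧ (∀ l, (|k l| : ℝ) ≤ C * δ ^ (-C)) ∧
              ∀ j, fracNorm (∑ l, (k l : ℝ) * γ j l) ≤ C * δ ^ (-C) / (Nv j : ℝ) := by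
  intro m t hm ht
  have hm1 : (1 : ℝ) ≤ m := by exact_mod_cast hm
  have ht1 : (1 : ℝ) ≤ t := by exact_mod_cast ht
  obtain ⟨B, hB⟩ : ∃ B : ℝ, B = 8 * 3 ^ t * (4 * (t + m)) * (8 * m ^ 2) ^ (m - 1) := ⟨_, rfl⟩
  have h8m : (1 : ℝ) ≤ 8 * m ^ 2 := by nlinarith
  have hB1 : 1 ≤ B := by
    rw [hB]
    have h1 : (1 : ℝ) ≤ 3 ^ t := one_le_pow₀ (by norm_num)
    have h2 : (1 : ℝ) ≤ (8 * m ^ 2) ^ (m - 1) := one_le_pow₀ h8m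
    have h3 : (1 : ℝ) ≤ 4 * (t + m) := by linarith
    exact one_le_mul_of_one_le_of_one_le
      (one_le_mul_of_one_le_of_one_le (by linarith) h3) h2
  obtain ⟨E, hE⟩ : ∃ E : ℝ, E = 4 * (t + m) * (8 * m ^ 2 * (2 * B)) ^ (m - 1) := ⟨_, rfl⟩
  have hE0 : 0 < E := by rw [hE]; positivity
  refine ⟨2 * m + 3 + 32 * m ^ 2 * B + (4 + 4 * (m + 1) * B) * 3 ^ t * E, by positivity, ?_⟩
  obtain ⟨C, hC⟩ : ∃ C : ℝ,
    C = 2 * m + 3 + 32 * m ^ 2 * B + (4 + 4 * (m + 1) * B) * 3 ^ t * E := ⟨_, rfl⟩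
  rw [← hC]
  have hCa : (0 : ℝ) ≤ 32 * m ^ 2 * B := by positivity
  have hCb : (0 : ℝ) ≤ (4 + 4 * (m + 1) * B) * 3 ^ t * E := by positivity
  have hC0 : 0 < C := by rw [hC]; positivity
  intro β α ζ γ δ N Nv hδ hδ2 hN hNv hα hζ hcount
  obtain ⟨X, hX⟩ : ∃ X : ℝ, X = δ⁻¹ := ⟨_, rfl⟩
  have hX0 : 0 < X := by rw [hX]; positivity
  have hXδ : X * δ = 1 := by rw [hX]; exact inv_mul_cancel₀ hδ.ne'
  have hX2 : 2 ≤ X := by nlinarith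
  have hX1 : 1 ≤ X := by linarith
  have hδC : δ ^ (-C) = X ^ C := by rw [hX, Real.rpow_neg hδ.le, Real.inv_rpow hδ.le]
  rw [hδC]
  have hpow : ∀ n : ℕ, (n : ℝ) ≤ C → X ^ n ≤ X ^ C := fun n hn => by
    rw [← Real.rpow_natCast]
    exact Real.rpow_le_rpow_of_exponent_le hX1 hn
  by_contra! hcon
  obtain ⟨⟨l₁, hl₁⟩, hcon⟩ := hcon
  obtain ⟨l₀, -, hl₀⟩ := Finset.exists_max_image Finset.univ (fun l => |ζ l|) ⟨l₁, Finset.mem_univ _⟩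
  have hN0 : 0 < N := by linarith
  have hZ : C * X ^ C / N < |ζ l₀| := hl₁.trans_le (hl₀ l₁ (Finset.mem_univ _))
  have hXC : 0 < X ^ C := Real.rpow_pos_of_pos hX0 C
  have hζ₀ : ζ l₀ ≠ 0 := by
    rw [← abs_pos]
    exact lt_trans (by positivity) hZ
  obtain ⟨Q, hQ⟩ : ∃ Q : ℕ, Q = ⌊B * X ^ 2⌋₊ + 1 := ⟨_, rfl⟩
  have hBX : 1 ≤ B * X ^ 2 := one_le_mul_of_one_le_of_one_le hB1 (one_le_pow₀ hX1)
  have hQl : B * X ^ 2 < Q := by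
    rw [hQ]
    push_cast
    exact Nat.lt_floor_add_one _
  have hQu : (Q : ℝ) ≤ 2 * B * X ^ 2 := by
    rw [hQ]
    push_cast
    linarith [Nat.floor_le (a := B * X ^ 2) (by linarith)]
  have hQ1 : 1 ≤ Q := by omega
  have hQ0 : (0 : ℝ) < Q := by exact_mod_cast hQ1
  have hprod : 0 < ∏ j, (Nv j : ℝ) := Finset.prod_pos fun j _ => by exact_mod_cast hNv j
  obtain ⟨H', hH'H, hH'card, hval, hcell⟩ := exists_dense_fiber β α ζ γ l₀ Nv (8 * m ^ 2 * Q)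
    (Nat.mul_pos (by positivity) hQ1) ((t + m) * X) (1 / (δ * N)) (by positivity)
    (by
      rw [add_mul]
      refine add_le_add ?_ ?_
      · calc ∑ j, |α j| * (Nv j : ℝ) ≤ ∑ _j : Fin t, X := Finset.sum_le_sum fun j _ => by
              have hNj : (0 : ℝ) < Nv j := by exact_mod_cast hNv j
              calc |α j| * (Nv j : ℝ) ≤ 1 / (δ * (Nv j : ℝ)) * Nv j :=
                    mul_le_mul_of_nonneg_right (hα j) hNj.le
                _ = X := by rw [hX]; field_simp
          _ = t * X := by simp
      · calc ∑ l, |ζ l| ≤ ∑ _l : Fin m, X := Finset.sum_le_sum fun l _ => by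
              rw [hX, ← one_div]
              exact hζ l
          _ = m * X := by simp)
    _ (Finset.filter_subset _ _) (fun h hh => (Finset.mem_filter.1 hh).2)
  have hcount' := hcount.trans hH'card
  have hc0 : (0 : ℝ) ≤ H'.card := Nat.cast_nonneg _
  have hW : 2 * ((t + m) * X) + 2 ≤ 4 * (t + m) * X := by nlinarith
  have hdense : ∏ j, (Nv j : ℝ)
      ≤ 4 * (t + m) * (8 * m ^ 2) ^ (m - 1) * X ^ 2 * (Q : ℝ) ^ (m - 1) * H'.card := by
    have h1 : X * (δ * ∏ j, (Nv j : ℝ))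
        ≤ X * ((2 * ((t + m) * X) + 2) * ((8 * m ^ 2 * Q : ℕ) : ℝ) ^ (m - 1) * H'.card) :=
      mul_le_mul_of_nonneg_left hcount' hX0.le
    rw [← mul_assoc, hXδ, one_mul] at h1
    refine h1.trans ?_
    calc _ ≤ X * (4 * (t + m) * X * ((8 * m ^ 2 * Q : ℕ) : ℝ) ^ (m - 1) * H'.card) := by
          gcongr
      _ = _ := by
          push_cast
          rw [mul_pow (8 * (m : ℝ) ^ 2) (Q : ℝ)]
          ring
  have hbox : ∀ s : Finset (Fin t), ∏ i ∈ s, (2 * (Nv i : ℝ) + 1) ≤ 3 ^ t * ∏ i ∈ s, (Nv i : ℝ) := by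
    intro s
    calc ∏ i ∈ s, (2 * (Nv i : ℝ) + 1) ≤ ∏ i ∈ s, (3 * (Nv i : ℝ)) :=
          Finset.prod_le_prod (fun _ _ => by positivity) fun i _ => by
            have : (1 : ℝ) ≤ Nv i := by exact_mod_cast hNv i
            linarith
      _ = 3 ^ s.card * ∏ i ∈ s, (Nv i : ℝ) := by rw [Finset.prod_mul_distrib, Finset.prod_const]
      _ ≤ _ := by
          refine mul_le_mul_of_nonneg_right ?_ (Finset.prod_nonneg fun _ _ => Nat.cast_nonneg _)
          refine pow_le_pow_right₀ (by norm_num) ?_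
          simpa using Finset.card_le_univ s
  have hcpos : (0 : ℝ) < H'.card := by
    rcases hc0.lt_or_eq with h | h
    · exact h
    · rw [← h, mul_zero] at hdense
      linarith
  have hQm : (Q : ℝ) ^ m = (Q : ℝ) ^ (m - 1) * Q := by
    rw [← pow_succ, Nat.sub_add_cancel hm]
  obtain ⟨k, hk0, hkQ, hk⟩ := exists_approx_relation_of_bracket Nv α ζ γ l₀ hζ₀
    (fun l => hl₀ l (Finset.mem_univ _)) Q hQ1 (1 / (δ * N)) (1 / ((8 * m ^ 2 * Q : ℕ) : ℝ))
    (by positivity)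
    (by
      push_cast
      rw [mul_one_div, div_self (by positivity)])
    (by
      push_cast
      rw [mul_one_div |ζ l₀|, le_div_iff₀ (by positivity)]
      refine le_trans ?_ hZ.le
      have e : 2 * (1 / (δ * N)) * (8 * m ^ 2 * Q) = 16 * m ^ 2 * Q * X / N := by
        rw [hX]
        field_simp
        ring
      rw [e]
      refine div_le_div_of_nonneg_right ?_ hN0.le
      calc 16 * m ^ 2 * Q * X ≤ 16 * m ^ 2 * (2 * B * X ^ 2) * X := by gcongr
        _ = 32 * m ^ 2 * B * X ^ 3 := by ring
        _ ≤ C * X ^ C := by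
          refine mul_le_mul (by rw [hC]; linarith) (hpow 3 ?_) (by positivity) hC0.le
          rw [hC]
          push_cast
          linarith)
    H' (hH'H.trans (Finset.filter_subset _ _)) hval hcell
    (by
      calc 8 * ∏ j, (2 * (Nv j : ℝ) + 1) ≤ 8 * (3 ^ t * ∏ j, (Nv j : ℝ)) := by
            linarith [hbox Finset.univ]
        _ ≤ 8 * (3 ^ t * (4 * (t + m) * (8 * m ^ 2) ^ (m - 1) * X ^ 2 * (Q : ℝ) ^ (m - 1)
              * H'.card)) := by gcongr
        _ = H'.card * ((Q : ℝ) ^ (m - 1) * (B * X ^ 2)) := by rw [hB]; ring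
        _ < H'.card * ((Q : ℝ) ^ (m - 1) * Q) := by gcongr
        _ = _ := by rw [hQm])
  obtain ⟨j, hj⟩ := hcon k hk0 (fun l => by
    refine (hkQ l).trans (hQu.trans ?_)
    refine mul_le_mul ?_ (hpow 2 ?_) (by positivity) hC0.le
    · rw [hC]
      nlinarith
    · rw [hC]
      push_cast
      linarith)
  refine absurd hj (not_lt.2 ?_)
  have hNj : (0 : ℝ) < Nv j := by exact_mod_cast hNv j
  rw [le_div_iff₀ hNj]
  refine le_of_mul_le_mul_left ?_ hcpos
  have hdense' : ∏ j, (Nv j : ℝ) ≤ E * X ^ (2 * m) * H'.card := by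
    refine hdense.trans ?_
    calc _ ≤ 4 * (t + m) * (8 * m ^ 2) ^ (m - 1) * X ^ 2 * (2 * B * X ^ 2) ^ (m - 1) * H'.card := by
          gcongr
      _ = 4 * (t + m) * (8 * m ^ 2 * (2 * B)) ^ (m - 1) * ((X ^ 2) ^ (m - 1) * X ^ 2)
            * H'.card := by
          rw [mul_pow (2 * B), mul_pow (8 * (m : ℝ) ^ 2) (2 * B)]
          ring
      _ = _ := by rw [hE, ← pow_succ, Nat.sub_add_cancel hm, ← pow_mul]
  calc H'.card * (fracNorm (∑ l, (k l : ℝ) * γ j l) * Nv j)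
      = H'.card * fracNorm (∑ l, (k l : ℝ) * γ j l) * Nv j := by ring
    _ ≤ (4 + 2 * (m + 1) * Q) * (3 ^ t * ∏ i ∈ Finset.univ.erase j, (Nv i : ℝ)) * Nv j := by
        refine mul_le_mul_of_nonneg_right ((hk j).trans ?_) hNj.le
        exact mul_le_mul_of_nonneg_left (hbox _) (by positivity)
    _ = (4 + 2 * (m + 1) * Q) * 3 ^ t * ∏ i, (Nv i : ℝ) := by
        rw [← Finset.mul_prod_erase _ _ (Finset.mem_univ j)]
        ring
    _ ≤ ((4 + 4 * (m + 1) * B) * X ^ 2) * 3 ^ t * (E * X ^ (2 * m) * H'.card) := by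
        refine mul_le_mul ?_ hdense' hprod.le (by positivity)
        refine mul_le_mul_of_nonneg_right ?_ (by positivity)
        have h1 : (1 : ℝ) ≤ X ^ 2 := one_le_pow₀ hX1
        have h2 : 2 * ((m : ℝ) + 1) * Q ≤ 2 * (m + 1) * (2 * B * X ^ 2) := by gcongr
        nlinarith
    _ = H'.card * ((4 + 4 * (m + 1) * B) * 3 ^ t * E * X ^ (2 * m + 2)) := by ring
    _ ≤ H'.card * (C * X ^ C) := by
        refine mul_le_mul_of_nonneg_left ?_ hc0
        refine mul_le_mul (by rw [hC]; linarith) (hpow _ ?_) (by positivity) hC0.le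
        rw [hC]
        push_cast
        linarith
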